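/- Resolution stability: if the well-resolved relation H ⊢ a ~ b ~ c : A holds, the logical typing ε ⊢ A : s is derivable, H is a wr-heap, and b is a value, then the heap constraint H ▷ s holds. -/

import Mathlib

namespace TLL

/-- The two sorts of TLL: `U` (non-linear) and `L` (linear). -/
inductive Srt : Type
  | U | L
deriving DecidableEq

/-- TLL terms in de Bruijn representation: variables, sorts, the two Π-type
formers (irrelevant `pi0` and relevant `pi1`), the two λ-formers, application,
the erased constant `box`, and heap pointers `ptr`. -/
inductive Tm : Type
  | var  : Nat → Tm
  | srt  : Srt → Tm
  | pi0  : Srt → Tm → Tm → Tm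
  | pi1  : Srt → Tm → Tm → Tm
  | lam0 : Srt → Tm → Tm → Tm
  | lam1 : Srt → Tm → Tm → Tm
  | app  : Tm → Tm → Tm
  | box  : Tm
  | ptr  : Nat → Tm

def upr (ξ : Nat → Nat) : Nat → Nat
  | 0 => 0
  | n + 1 => ξ n + 1

def rename (ξ : Nat → Nat) : Tm → Tm
  | .var x => .var (ξ x)
  | .srt s => .srt s
  | .pi0 t A B => .pi0 t (rename ξ A) (rename (upr ξ) B)
  | .pi1 t A B => .pi1 t (rename ξ A) (rename (upr ξ) B)
  | .lam0 t A m => .lam0 t (rename ξ A) (rename (upr ξ) m)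
  | .lam1 t A m => .lam1 t (rename ξ A) (rename (upr ξ) m)
  | .app m n => .app (rename ξ m) (rename ξ n)
  | .box => .box
  | .ptr l => .ptr l

def up (σ : Nat → Tm) : Nat → Tm
  | 0 => .var 0
  | n + 1 => rename Nat.succ (σ n)

def subst (σ : Nat → Tm) : Tm → Tm
  | .var x => σ x
  | .srt s => .srt s
  | .pi0 t A B => .pi0 t (subst σ A) (subst (up σ) B)
  | .pi1 t A B => .pi1 t (subst σ A) (subst (up σ) B)
  | .lam0 t A m => .lam0 t (subst σ A) (subst (up σ) m)
  | .lam1 t A m => .lam1 t (subst σ A) (subst (up σ) m)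
  | .app m n => .app (subst σ m) (subst σ n)
  | .box => .box
  | .ptr l => .ptr l

/-- `subst1 n m` is `m[n/x]` for the topmost bound variable `x`. -/
def subst1 (n : Tm) (m : Tm) : Tm :=
  subst (fun i => match i with | 0 => n | i + 1 => .var i) m

/-- Logical one-step reduction `m ~> n`: full β-reduction with both β-rules,
closed under all structural subterm positions. -/
inductive LStep : Tm → Tm → Prop
  | beta0 {t A m n} : LStep (.app (.lam0 t A m) n) (subst1 n m)
  | beta1 {t A m n} : LStep (.app (.lam1 t A m) n) (subst1 n m)
  | appL {m m' n} : LStep m m' → LStep (.app m n) (.app m' n)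
  | appR {m n n'} : LStep n n' → LStep (.app m n) (.app m n')
  | pi0A {t A A' B} : LStep A A' → LStep (.pi0 t A B) (.pi0 t A' B)
  | pi0B {t A B B'} : LStep B B' → LStep (.pi0 t A B) (.pi0 t A B')
  | pi1A {t A A' B} : LStep A A' → LStep (.pi1 t A B) (.pi1 t A' B)
  | pi1B {t A B B'} : LStep B B' → LStep (.pi1 t A B) (.pi1 t A B')
  | lam0A {t A A' m} : LStep A A' → LStep (.lam0 t A m) (.lam0 t A' m)
  | lam0M {t A m m'} : LStep m m' → LStep (.lam0 t A m) (.lam0 t A m')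
  | lam1A {t A A' m} : LStep A A' → LStep (.lam1 t A m) (.lam1 t A' m)
  | lam1M {t A m m'} : LStep m m' → LStep (.lam1 t A m) (.lam1 t A m')

/-- Multi-step logical reduction. -/
abbrev LRed : Tm → Tm → Prop := Relation.ReflTransGen LStep

/-- Definitional equality `A ≃ B`: equivalence closure of logical reduction. -/
def Conv (A B : Tm) : Prop := Relation.EqvGen LStep A B

/-- Parallel logical reduction `m ⇒ n`. -/
inductive PStep : Tm → Tm → Prop
  | var {x} : PStep (.var x) (.var x)
  | srt {s} : PStep (.srt s) (.srt s)
  | box : PStep .box .box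
  | ptr {l} : PStep (.ptr l) (.ptr l)
  | pi0 {t A A' B B'} : PStep A A' → PStep B B' → PStep (.pi0 t A B) (.pi0 t A' B')
  | pi1 {t A A' B B'} : PStep A A' → PStep B B' → PStep (.pi1 t A B) (.pi1 t A' B')
  | lam0 {t A A' m m'} : PStep A A' → PStep m m' → PStep (.lam0 t A m) (.lam0 t A' m')
  | lam1 {t A A' m m'} : PStep A A' → PStep m m' → PStep (.lam1 t A m) (.lam1 t A' m')
  | app {m m' n n'} : PStep m m' → PStep n n' → PStep (.app m n) (.app m' n')
  | beta0 {t A m m' n n'} : PStep m m' → PStep n n' →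
      PStep (.app (.lam0 t A m) n) (subst1 n' m')
  | beta1 {t A m m' n n'} : PStep m m' → PStep n n' →
      PStep (.app (.lam1 t A m) n) (subst1 n' m')

/-- Logical contexts: lists of types (de Bruijn). -/
abbrev Ctx := List Tm

/-- `Has Γ x A`: variable `x` has type `A` in logical context `Γ`
(with the appropriate de Bruijn shifts). -/
inductive Has : Ctx → Nat → Tm → Prop
  | zero {Γ A} : Has (A :: Γ) 0 (rename Nat.succ A)
  | succ {Γ x A B} : Has Γ x A → Has (B :: Γ) (x + 1) (rename Nat.succ A)

mutual
/-- Well-formed logical contexts. -/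
inductive LWf : Ctx → Prop
  | nil : LWf []
  | cons {Γ A s} : LWf Γ → LTyped Γ A (.srt s) → LWf (A :: Γ)

/-- The logical typing judgment `Γ ⊢ m : A`. -/
inductive LTyped : Ctx → Tm → Tm → Prop
  | srt {Γ} (s : Srt) : LWf Γ → LTyped Γ (.srt s) (.srt .U)
  | var {Γ x A} : LWf Γ → Has Γ x A → LTyped Γ (.var x) A
  | pi0 {Γ A B s r} (t : Srt) :
      LTyped Γ A (.srt s) → LTyped (A :: Γ) B (.srt r) →
      LTyped Γ (.pi0 t A B) (.srt t)
  | pi1 {Γ A B s r} (t : Srt) :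
      LTyped Γ A (.srt s) → LTyped (A :: Γ) B (.srt r) →
      LTyped Γ (.pi1 t A B) (.srt t)
  | lam0 {Γ A B m} (t : Srt) :
      LTyped (A :: Γ) m B → LTyped Γ (.lam0 t A m) (.pi0 t A B)
  | lam1 {Γ A B m} (t : Srt) :
      LTyped (A :: Γ) m B → LTyped Γ (.lam1 t A m) (.pi1 t A B)
  | app0 {Γ m n A B t} :
      LTyped Γ m (.pi0 t A B) → LTyped Γ n A → LTyped Γ (.app m n) (subst1 n B)
  | app1 {Γ m n A B t} :
      LTyped Γ m (.pi1 t A B) → LTyped Γ n A → LTyped Γ (.app m n) (subst1 n B)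
  | conv {Γ m A B s} :
      LTyped Γ m A → LTyped Γ B (.srt s) → Conv A B → LTyped Γ m B
end

/-- Program context entries: either absent, or a sort-annotated type. -/
abbrev Entry := Option (Srt × Tm)

/-- Program contexts, positionally aligned with the logical context. -/
abbrev PCtx := List Entry

/-- The context constraint `Δ ▷ s`. -/
inductive Restr : PCtx → Srt → Prop
  | nil {s} : Restr [] s
  | skip {Δ s} : Restr Δ s → Restr ((none : Entry) :: Δ) s
  | u {Δ A} : Restr Δ .U → Restr (some (.U, A) :: Δ) .U
  | l {Δ s A} : Restr Δ .L → Restr (some (s, A) :: Δ) .L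

/-- Context merge `Δ₁ ∪̇ Δ₂ = Δ`: contraction on shared `U` entries,
`L` entries occur on exactly one side. -/
inductive Merge : PCtx → PCtx → PCtx → Prop
  | nil : Merge [] [] []
  | contra {Δ₁ Δ₂ Δ A} : Merge Δ₁ Δ₂ Δ →
      Merge (some (.U, A) :: Δ₁) (some (.U, A) :: Δ₂) (some (.U, A) :: Δ)
  | left {Δ₁ Δ₂ Δ A} : Merge Δ₁ Δ₂ Δ →
      Merge (some (.L, A) :: Δ₁) ((none : Entry) :: Δ₂) (some (.L, A) :: Δ)
  | right {Δ₁ Δ₂ Δ A} : Merge Δ₁ Δ₂ Δ →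
      Merge ((none : Entry) :: Δ₁) (some (.L, A) :: Δ₂) (some (.L, A) :: Δ)
  | skip {Δ₁ Δ₂ Δ} : Merge Δ₁ Δ₂ Δ →
      Merge ((none : Entry) :: Δ₁) ((none : Entry) :: Δ₂) ((none : Entry) :: Δ)

/-- `PHas Δ x s A`: the entry `x :s A` occurs in `Δ` and the rest of `Δ`
satisfies `▷ U` (so no linear entry is discarded). -/
inductive PHas : PCtx → Nat → Srt → Tm → Prop
  | zero {Δ s A} : Restr Δ .U → PHas (some (s, A) :: Δ) 0 s (rename Nat.succ A)
  | succN {Δ x s A} : PHas Δ x s A → PHas ((none : Entry) :: Δ) (x + 1) s (rename Nat.succ A)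
  | succU {Δ x s A B} : PHas Δ x s A → PHas (some (.U, B) :: Δ) (x + 1) s (rename Nat.succ A)

/-- Well-formed pairs of logical and program contexts `Γ ; Δ ⊢`. -/
inductive PWf : Ctx → PCtx → Prop
  | nil : PWf [] []
  | cons {Γ Δ A s} : PWf Γ Δ → LTyped Γ A (.srt s) → PWf (A :: Γ) (some (s, A) :: Δ)
  | consN {Γ Δ A s} : PWf Γ Δ → LTyped Γ A (.srt s) → PWf (A :: Γ) ((none : Entry) :: Δ)

/-- The program typing judgment `Γ ; Δ ⊢ m : A`. -/
inductive PTyped : Ctx → PCtx → Tm → Tm → Prop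
  | var {Γ Δ x s A} : PWf Γ Δ → PHas Δ x s A → PTyped Γ Δ (.var x) A
  | lam0 {Γ Δ A B m} (t : Srt) :
      PTyped (A :: Γ) ((none : Entry) :: Δ) m B → Restr Δ t →
      PTyped Γ Δ (.lam0 t A m) (.pi0 t A B)
  | lam1 {Γ Δ A B m s} (t : Srt) :
      PTyped (A :: Γ) (some (s, A) :: Δ) m B → Restr Δ t →
      PTyped Γ Δ (.lam1 t A m) (.pi1 t A B)
  | app0 {Γ Δ m n A B t} :
      PTyped Γ Δ m (.pi0 t A B) → LTyped Γ n A →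
      PTyped Γ Δ (.app m n) (subst1 n B)
  | app1 {Γ Δ₁ Δ₂ Δ m n A B t} :
      PTyped Γ Δ₁ m (.pi1 t A B) → PTyped Γ Δ₂ n A → Merge Δ₁ Δ₂ Δ →
      PTyped Γ Δ (.app m n) (subst1 n B)
  | conv {Γ Δ m A B s} :
      PTyped Γ Δ m A → LTyped Γ B (.srt s) → Conv A B →
      PTyped Γ Δ m B

/-- Program values. -/
inductive Value : Tm → Prop
  | var {x} : Value (.var x)
  | lam0 {t A m} : Value (.lam0 t A m)
  | lam1 {t A m} : Value (.lam1 t A m)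

/-- Program (call-by-value) one-step reduction `m ~~> n`. -/
inductive CStep : Tm → Tm → Prop
  | appL {m m' n} : CStep m m' → CStep (.app m n) (.app m' n)
  | appR {m n n'} : CStep n n' → CStep (.app m n) (.app m n')
  | beta0 {t A m n} : CStep (.app (.lam0 t A m) n) (subst1 n m)
  | beta1 {t A m v} : Value v → CStep (.app (.lam1 t A m) v) (subst1 v m)

/-- The erasure judgment `Γ ; Δ ⊢ m ~ m' : A`. -/
inductive Erase : Ctx → PCtx → Tm → Tm → Tm → Prop
  | var {Γ Δ x s A} : PWf Γ Δ → PHas Δ x s A → Erase Γ Δ (.var x) (.var x) A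
  | lam0 {Γ Δ A B m m'} (t : Srt) :
      Erase (A :: Γ) ((none : Entry) :: Δ) m m' B → Restr Δ t →
      Erase Γ Δ (.lam0 t A m) (.lam0 t .box m') (.pi0 t A B)
  | lam1 {Γ Δ A B m m' s} (t : Srt) :
      Erase (A :: Γ) (some (s, A) :: Δ) m m' B → Restr Δ t →
      Erase Γ Δ (.lam1 t A m) (.lam1 t .box m') (.pi1 t A B)
  | app0 {Γ Δ m m' n A B t} :
      Erase Γ Δ m m' (.pi0 t A B) → LTyped Γ n A →
      Erase Γ Δ (.app m n) (.app m' .box) (subst1 n B)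
  | app1 {Γ Δ₁ Δ₂ Δ m m' n n' A B t} :
      Erase Γ Δ₁ m m' (.pi1 t A B) → Erase Γ Δ₂ n n' A → Merge Δ₁ Δ₂ Δ →
      Erase Γ Δ (.app m n) (.app m' n') (subst1 n B)
  | conv {Γ Δ m m' A B s} :
      Erase Γ Δ m m' A → LTyped Γ B (.srt s) → Conv A B →
      Erase Γ Δ m m' B

/-- Heaps: finite maps from locations to sort-annotated values. -/
abbrev Heap := Nat → Option (Srt × Tm)

/-- Heap lookup `Lookup H₁ l v H₂`: non-linear cells persist, linear cells
are deallocated. -/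
inductive Lookup : Heap → Nat → Tm → Heap → Prop
  | u {H l v} : H l = some (.U, v) → Lookup H l v H
  | l {H l v} : H l = some (.L, v) → Lookup H l v (Function.update H l none)

/-- Heap merge `H₁ ∪̇ H₂ = H`. -/
def HMerge (H₁ H₂ H : Heap) : Prop := ∀ l,
  (H₁ l = none ∧ H₂ l = none ∧ H l = none) ∨
  (∃ v, H₁ l = some (.U, v) ∧ H₂ l = some (.U, v) ∧ H l = some (.U, v)) ∨
  (∃ v, H₁ l = some (.L, v) ∧ H₂ l = none ∧ H l = some (.L, v)) ∨
  (∃ v, H₁ l = none ∧ H₂ l = some (.L, v) ∧ H l = some (.L, v))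

/-- The heap constraint `H ▷ s`. -/
def HRestr (H : Heap) : Srt → Prop
  | .U => ∀ l s v, H l = some (s, v) → s = Srt.U
  | .L => True

/-- Heap reduction `H ; m ~~> H' ; m'`. -/
inductive HStep : Heap → Tm → Heap → Tm → Prop
  | alloc0 {H l t m} : H l = none →
      HStep H (.lam0 t .box m) (Function.update H l (some (t, .lam0 t .box m))) (.ptr l)
  | alloc1 {H l t m} : H l = none →
      HStep H (.lam1 t .box m) (Function.update H l (some (t, .lam1 t .box m))) (.ptr l)
  | appL {H H' m m' n} : HStep H m H' m' → HStep H (.app m n) H' (.app m' n)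
  | appR {H H' m n n'} : HStep H n H' n' → HStep H (.app m n) H' (.app m n')
  | beta0 {H H' l t m n} : Lookup H l (.lam0 t .box m) H' →
      HStep H (.app (.ptr l) n) H' (subst1 .box m)
  | beta1 {H H' l₁ l₂ t m} : Lookup H l₁ (.lam1 t .box m) H' →
      HStep H (.app (.ptr l₁) (.ptr l₂)) H' (subst1 (.ptr l₂) m)

/-- Pointer resolution `H ; m ~ n`. -/
inductive Resolve : Heap → Tm → Tm → Prop
  | var {H x} : HRestr H .U → Resolve H (.var x) (.var x)
  | lam0 {H t m' m} : HRestr H t → Resolve H m' m →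
      Resolve H (.lam0 t .box m') (.lam0 t .box m)
  | lam1 {H t m' m} : HRestr H t → Resolve H m' m →
      Resolve H (.lam1 t .box m') (.lam1 t .box m)
  | app0 {H m' m} : Resolve H m' m → Resolve H (.app m' .box) (.app m .box)
  | app1 {H₁ H₂ H m' m n' n} : HMerge H₁ H₂ H →
      Resolve H₁ m' m → Resolve H₂ n' n → Resolve H (.app m' n') (.app m n)
  | ptr {H H' l v' v} : Lookup H l v' H' → Resolve H' v' v → Resolve H (.ptr l) v

/-- `ClosedUnder k m`: all free de Bruijn variables of `m` are `< k`. -/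
def ClosedUnder : Nat → Tm → Prop
  | k, .var x => x < k
  | _, .srt _ => True
  | k, .pi0 _ A B => ClosedUnder k A ∧ ClosedUnder (k + 1) B
  | k, .pi1 _ A B => ClosedUnder k A ∧ ClosedUnder (k + 1) B
  | k, .lam0 _ A m => ClosedUnder k A ∧ ClosedUnder (k + 1) m
  | k, .lam1 _ A m => ClosedUnder k A ∧ ClosedUnder (k + 1) m
  | k, .app m n => ClosedUnder k m ∧ ClosedUnder k n
  | _, .box => True
  | _, .ptr _ => True

/-- WR-heaps: heaps plausibly produced by heap reduction. -/
inductive WrHeap : Heap → Prop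
  | nil : WrHeap (fun _ => none)
  | lam0 {H l t m} : ClosedUnder 1 m → WrHeap H → H l = none →
      WrHeap (Function.update H l (some (t, .lam0 t .box m)))
  | lam1 {H l t m} : ClosedUnder 1 m → WrHeap H → H l = none →
      WrHeap (Function.update H l (some (t, .lam1 t .box m)))

/-- Well-resolved `H ⊢ a ~ b ~ c : A`. -/
def WellResolved (H : Heap) (a b c A : Tm) : Prop :=
  Erase [] [] a b A ∧ Resolve H c b


/-! ### Substitution calculus -/

/-- Extension of a substitution by a term for variable `0`. -/
def scons (n : Tm) (σ : Nat → Tm) : Nat → Tm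
  | 0 => n
  | i + 1 => σ i

theorem subst1_eq (n m : Tm) : subst1 n m = subst (scons n .var) m :=
  rfl

theorem up_var_comp (ξ : Nat → Nat) :
    up (fun x => .var (ξ x)) = fun x => .var (upr ξ x) := by
  funext x
  cases x <;> rfl

theorem up_var : up .var = .var := by
  funext x
  cases x <;> rfl

theorem rename_eq_subst (m : Tm) (ξ : Nat → Nat) :
    rename ξ m = subst (fun x => .var (ξ x)) m := by
  induction m generalizing ξ <;> simp_all [rename, subst, up_var_comp]

theorem subst_var (m : Tm) : subst .var m = m := by
  induction m <;> simp_all [subst, up_var]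

theorem up_comp_upr (σ : Nat → Tm) (ξ : Nat → Nat) :
    (fun x => up σ (upr ξ x)) = up (fun x => σ (ξ x)) := by
  funext x
  cases x <;> rfl

theorem subst_rename (m : Tm) (σ : Nat → Tm) (ξ : Nat → Nat) :
    subst σ (rename ξ m) = subst (fun x => σ (ξ x)) m := by
  induction m generalizing σ ξ <;> simp_all [rename, subst, up_comp_upr]

theorem rename_rename (m : Tm) (ξ ζ : Nat → Nat) :
    rename ξ (rename ζ m) = rename (fun x => ξ (ζ x)) m := by
  rw [rename_eq_subst, subst_rename, rename_eq_subst]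

theorem rename_comp_up (σ : Nat → Tm) (ξ : Nat → Nat) :
    (fun x => rename (upr ξ) (up σ x)) = up (fun x => rename ξ (σ x)) := by
  funext x
  cases x with
  | zero => rfl
  | succ x => simp [up, rename_rename, upr]

theorem rename_subst (m : Tm) (σ : Nat → Tm) (ξ : Nat → Nat) :
    rename ξ (subst σ m) = subst (fun x => rename ξ (σ x)) m := by
  induction m generalizing σ ξ <;> simp_all [rename, subst, rename_comp_up]

theorem subst_comp_up (σ τ : Nat → Tm) :
    (fun x => subst (up τ) (up σ x)) = up (fun x => subst τ (σ x)) := by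
  funext x
  cases x with
  | zero => rfl
  | succ x => simp [up, subst_rename, rename_subst]

theorem subst_subst (m : Tm) (σ τ : Nat → Tm) :
    subst τ (subst σ m) = subst (fun x => subst τ (σ x)) m := by
  induction m generalizing σ τ <;> simp_all [subst, subst_comp_up]

theorem subst_scons_rename_succ (m n : Tm) (σ : Nat → Tm) :
    subst (scons n σ) (rename Nat.succ m) = subst σ m := by
  rw [subst_rename]
  rfl

theorem subst_up_rename_succ (m : Tm) (σ : Nat → Tm) :
    subst (up σ) (rename Nat.succ m) = rename Nat.succ (subst σ m) := by
  rw [subst_rename, rename_subst]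
  rfl

theorem subst_subst1 (m n : Tm) (σ : Nat → Tm) :
    subst σ (subst1 n m) = subst1 (subst σ n) (subst (up σ) m) := by
  rw [subst1_eq, subst1_eq, subst_subst, subst_subst]
  congr 1
  funext x
  cases x with
  | zero => rfl
  | succ x => simp [scons, up, subst_scons_rename_succ, subst_var, subst]

theorem rename_subst1 (m n : Tm) (ξ : Nat → Nat) :
    rename ξ (subst1 n m) = subst1 (rename ξ n) (rename (upr ξ) m) := by
  rw [rename_eq_subst, subst_subst1, up_var_comp, ← rename_eq_subst, ← rename_eq_subst]

/-! ### Parallel reduction and confluence -/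

theorem PStep.refl (m : Tm) : PStep m m := by
  induction m <;> constructor <;> assumption

theorem PStep.rename {m n : Tm} (h : PStep m n) (ξ : Nat → Nat) :
    PStep (TLL.rename ξ m) (TLL.rename ξ n) := by
  induction h generalizing ξ with
  | beta0 _ _ ihm ihn => rw [rename_subst1]; exact .beta0 (ihm _) (ihn _)
  | beta1 _ _ ihm ihn => rw [rename_subst1]; exact .beta1 (ihm _) (ihn _)
  | _ => constructor <;> apply_assumption

theorem PStep.up {σ τ : Nat → Tm} (h : ∀ x, PStep (σ x) (τ x)) (x : Nat) :
    PStep (TLL.up σ x) (TLL.up τ x) := by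
  cases x with
  | zero => exact .var
  | succ x => exact (h x).rename _

theorem PStep.subst {m n : Tm} (h : PStep m n) {σ τ : Nat → Tm}
    (hσ : ∀ x, PStep (σ x) (τ x)) : PStep (TLL.subst σ m) (TLL.subst τ n) := by
  induction h generalizing σ τ with
  | var => exact hσ _
  | srt => exact .srt
  | box => exact .box
  | ptr => exact .ptr
  | pi0 _ _ ihA ihB => exact .pi0 (ihA hσ) (ihB (PStep.up hσ))
  | pi1 _ _ ihA ihB => exact .pi1 (ihA hσ) (ihB (PStep.up hσ))
  | lam0 _ _ ihA ihm => exact .lam0 (ihA hσ) (ihm (PStep.up hσ))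
  | lam1 _ _ ihA ihm => exact .lam1 (ihA hσ) (ihm (PStep.up hσ))
  | app _ _ ihm ihn => exact .app (ihm hσ) (ihn hσ)
  | beta0 _ _ ihm ihn => rw [subst_subst1]; exact .beta0 (ihm (PStep.up hσ)) (ihn hσ)
  | beta1 _ _ ihm ihn => rw [subst_subst1]; exact .beta1 (ihm (PStep.up hσ)) (ihn hσ)

theorem PStep.subst1 {m m' n n' : Tm} (hm : PStep m m') (hn : PStep n n') :
    PStep (TLL.subst1 n m) (TLL.subst1 n' m') := by
  rw [subst1_eq, subst1_eq]
  refine hm.subst fun x => ?_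
  cases x with
  | zero => exact hn
  | succ x => exact .var

/-- Complete development: contracts every redex of a term simultaneously. -/
def dev : Tm → Tm
  | .var x => .var x
  | .srt s => .srt s
  | .pi0 t A B => .pi0 t (dev A) (dev B)
  | .pi1 t A B => .pi1 t (dev A) (dev B)
  | .lam0 t A m => .lam0 t (dev A) (dev m)
  | .lam1 t A m => .lam1 t (dev A) (dev m)
  | .app (.lam0 _ _ m) n => subst1 (dev n) (dev m)
  | .app (.lam1 _ _ m) n => subst1 (dev n) (dev m)
  | .app m n => .app (dev m) (dev n)
  | .box => .box
  | .ptr l => .ptr l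

theorem PStep.dev {m n : Tm} (h : PStep m n) : PStep n (TLL.dev m) := by
  induction h with
  | var => exact .var
  | srt => exact .srt
  | box => exact .box
  | ptr => exact .ptr
  | pi0 _ _ ihA ihB => exact .pi0 ihA ihB
  | pi1 _ _ ihA ihB => exact .pi1 ihA ihB
  | lam0 _ _ ihA ihm => exact .lam0 ihA ihm
  | lam1 _ _ ihA ihm => exact .lam1 ihA ihm
  | beta0 _ _ ihm ihn => exact ihm.subst1 ihn
  | beta1 _ _ ihm ihn => exact ihm.subst1 ihn
  | @app m _ _ _ hm _ ihm ihn =>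
    cases m with
    | lam0 =>
      cases hm
      cases ihm with
      | lam0 _ hb => exact .beta0 hb ihn
    | lam1 =>
      cases hm
      cases ihm with
      | lam1 _ hb => exact .beta1 hb ihn
    | _ => exact .app ihm ihn

theorem LStep.toPStep {m n : Tm} (h : LStep m n) : PStep m n := by
  induction h with
  | beta0 => exact .beta0 (.refl _) (.refl _)
  | beta1 => exact .beta1 (.refl _) (.refl _)
  | _ => constructor <;> first | assumption | exact .refl _

theorem LRed.congr₂ {f : Tm → Tm → Tm} (hl : ∀ {a a' b}, LStep a a' → LStep (f a b) (f a' b))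
    (hr : ∀ {a b b'}, LStep b b' → LStep (f a b) (f a b')) {a a' b b' : Tm}
    (ha : LRed a a') (hb : LRed b b') : LRed (f a b) (f a' b') :=
  (ha.lift (f · b) fun _ _ => hl).trans (hb.lift (f a') fun _ _ => hr)

theorem PStep.toLRed {m n : Tm} (h : PStep m n) : LRed m n := by
  induction h with
  | var | srt | box | ptr => exact .refl
  | pi0 _ _ ihA ihB => exact LRed.congr₂ (f := .pi0 _) .pi0A .pi0B ihA ihB
  | pi1 _ _ ihA ihB => exact LRed.congr₂ (f := .pi1 _) .pi1A .pi1B ihA ihB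
  | lam0 _ _ ihA ihm => exact LRed.congr₂ (f := .lam0 _) .lam0A .lam0M ihA ihm
  | lam1 _ _ ihA ihm => exact LRed.congr₂ (f := .lam1 _) .lam1A .lam1M ihA ihm
  | app _ _ ihm ihn => exact LRed.congr₂ (f := .app) .appL .appR ihm ihn
  | @beta0 t A _ _ _ _ _ _ ihm ihn =>
    exact (LRed.congr₂ (f := fun m n => .app (.lam0 t A m) n)
      (fun h => .appL (.lam0M h)) .appR ihm ihn).tail .beta0
  | @beta1 t A _ _ _ _ _ _ ihm ihn =>
    exact (LRed.congr₂ (f := fun m n => .app (.lam1 t A m) n)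
      (fun h => .appL (.lam1M h)) .appR ihm ihn).tail .beta1

theorem reflTransGen_pStep_iff {m n : Tm} : Relation.ReflTransGen PStep m n ↔ LRed m n := by
  refine ⟨fun h => ?_, fun h => .mono (fun _ _ => LStep.toPStep) _ _ h⟩
  induction h with
  | refl => exact .refl
  | tail _ h ih => exact ih.trans h.toLRed

theorem LRed.confluent {m n₁ n₂ : Tm} (h₁ : LRed m n₁) (h₂ : LRed m n₂) :
    ∃ k, LRed n₁ k ∧ LRed n₂ k := by
  obtain ⟨k, hk₁, hk₂⟩ := Relation.church_rosser
    (fun a _ _ hb hc => ⟨dev a, .single hb.dev, .single hc.dev⟩)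
    (reflTransGen_pStep_iff.2 h₁) (reflTransGen_pStep_iff.2 h₂)
  exact ⟨k, reflTransGen_pStep_iff.1 hk₁, reflTransGen_pStep_iff.1 hk₂⟩

/-! ### Definitional equality -/

theorem Conv.refl (A : Tm) : Conv A A := Relation.EqvGen.refl A

theorem Conv.symm {A B : Tm} (h : Conv A B) : Conv B A := Relation.EqvGen.symm _ _ h

theorem Conv.trans {A B C : Tm} (h₁ : Conv A B) (h₂ : Conv B C) : Conv A C :=
  Relation.EqvGen.trans _ _ _ h₁ h₂

theorem LStep.toConv {A B : Tm} (h : LStep A B) : Conv A B := Relation.EqvGen.rel _ _ h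

theorem LRed.toConv {A B : Tm} (h : LRed A B) : Conv A B := by
  induction h with
  | refl => exact .refl _
  | tail _ h ih => exact ih.trans h.toConv

theorem Conv.join {A B : Tm} (h : Conv A B) : ∃ C, LRed A C ∧ LRed B C := by
  induction h with
  | rel _ _ h => exact ⟨_, .single h, .refl⟩
  | refl => exact ⟨_, .refl, .refl⟩
  | symm _ _ _ ih => obtain ⟨C, h₁, h₂⟩ := ih; exact ⟨C, h₂, h₁⟩
  | trans _ _ _ _ _ ih₁ ih₂ =>
    obtain ⟨C, h₁, h₂⟩ := ih₁
    obtain ⟨D, h₃, h₄⟩ := ih₂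
    obtain ⟨E, h₅, h₆⟩ := LRed.confluent h₂ h₃
    exact ⟨E, h₁.trans h₅, h₄.trans h₆⟩

theorem LStep.subst {m n : Tm} (h : LStep m n) (σ : Nat → Tm) :
    LStep (TLL.subst σ m) (TLL.subst σ n) := by
  induction h generalizing σ with
  | beta0 => rw [subst_subst1]; exact .beta0
  | beta1 => rw [subst_subst1]; exact .beta1
  | appL _ ih => exact .appL (ih _)
  | appR _ ih => exact .appR (ih _)
  | pi0A _ ih => exact .pi0A (ih _)
  | pi0B _ ih => exact .pi0B (ih _)
  | pi1A _ ih => exact .pi1A (ih _)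
  | pi1B _ ih => exact .pi1B (ih _)
  | lam0A _ ih => exact .lam0A (ih _)
  | lam0M _ ih => exact .lam0M (ih _)
  | lam1A _ ih => exact .lam1A (ih _)
  | lam1M _ ih => exact .lam1M (ih _)

theorem Conv.subst {A B : Tm} (h : Conv A B) (σ : Nat → Tm) :
    Conv (TLL.subst σ A) (TLL.subst σ B) := by
  induction h with
  | rel _ _ h => exact (h.subst σ).toConv
  | refl => exact .refl _
  | symm _ _ _ ih => exact ih.symm
  | trans _ _ _ _ _ ih₁ ih₂ => exact ih₁.trans ih₂

theorem Conv.rename {A B : Tm} (h : Conv A B) (ξ : Nat → Nat) :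
    Conv (TLL.rename ξ A) (TLL.rename ξ B) := by
  rw [rename_eq_subst, rename_eq_subst]
  exact h.subst _

theorem Conv.subst1 {A B : Tm} (h : Conv A B) (n : Tm) :
    Conv (TLL.subst1 n A) (TLL.subst1 n B) := by
  rw [subst1_eq, subst1_eq]
  exact h.subst _

theorem LStep.conv_subst1 {n n' : Tm} (h : LStep n n') (B : Tm) :
    Conv (subst1 n B) (subst1 n' B) :=
  ((PStep.refl B).subst1 h.toPStep).toLRed.toConv

theorem LRed.srt_inv {s : Srt} {C : Tm} (h : LRed (.srt s) C) : C = .srt s := by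
  induction h with
  | refl => rfl
  | tail _ h ih => subst ih; cases h

theorem LRed.pi0_inv {t : Srt} {A B C : Tm} (h : LRed (.pi0 t A B) C) :
    ∃ A' B', C = .pi0 t A' B' ∧ LRed A A' ∧ LRed B B' := by
  induction h with
  | refl => exact ⟨A, B, rfl, .refl, .refl⟩
  | tail _ h ih =>
    obtain ⟨A', B', rfl, hA, hB⟩ := ih
    cases h with
    | pi0A h => exact ⟨_, _, rfl, hA.tail h, hB⟩
    | pi0B h => exact ⟨_, _, rfl, hA, hB.tail h⟩

theorem LRed.pi1_inv {t : Srt} {A B C : Tm} (h : LRed (.pi1 t A B) C) :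
    ∃ A' B', C = .pi1 t A' B' ∧ LRed A A' ∧ LRed B B' := by
  induction h with
  | refl => exact ⟨A, B, rfl, .refl, .refl⟩
  | tail _ h ih =>
    obtain ⟨A', B', rfl, hA, hB⟩ := ih
    cases h with
    | pi1A h => exact ⟨_, _, rfl, hA.tail h, hB⟩
    | pi1B h => exact ⟨_, _, rfl, hA, hB.tail h⟩

theorem Conv.srt_inj {s t : Srt} (h : Conv (.srt s) (.srt t)) : s = t := by
  obtain ⟨C, h₁, h₂⟩ := h.join
  cases h₁.srt_inv
  cases h₂.srt_inv
  rfl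

theorem Conv.pi0_inj {t t' : Srt} {A A' B B' : Tm} (h : Conv (.pi0 t A B) (.pi0 t' A' B')) :
    Conv A A' ∧ Conv B B' := by
  obtain ⟨C, h₁, h₂⟩ := h.join
  obtain ⟨_, _, rfl, hA, hB⟩ := h₁.pi0_inv
  obtain ⟨_, _, h, hA', hB'⟩ := h₂.pi0_inv
  cases h
  exact ⟨hA.toConv.trans hA'.toConv.symm, hB.toConv.trans hB'.toConv.symm⟩

theorem Conv.pi1_inj {t t' : Srt} {A A' B B' : Tm} (h : Conv (.pi1 t A B) (.pi1 t' A' B')) :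
    Conv A A' ∧ Conv B B' := by
  obtain ⟨C, h₁, h₂⟩ := h.join
  obtain ⟨_, _, rfl, hA, hB⟩ := h₁.pi1_inv
  obtain ⟨_, _, h, hA', hB'⟩ := h₂.pi1_inv
  cases h
  exact ⟨hA.toConv.trans hA'.toConv.symm, hB.toConv.trans hB'.toConv.symm⟩

theorem not_conv_pi0_pi1 {t t' : Srt} {A A' B B' : Tm} :
    ¬ Conv (.pi0 t A B) (.pi1 t' A' B') := by
  intro h
  obtain ⟨C, h₁, h₂⟩ := h.join
  obtain ⟨_, _, rfl, -, -⟩ := h₁.pi0_inv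
  obtain ⟨_, _, h, -, -⟩ := h₂.pi1_inv
  cases h

/-! ### Logical typing without context well-formedness -/

/-- Logical typing in which context well-formedness is not checked at the leaves and the
binder annotations of λ-abstractions are checked explicitly instead. -/
inductive PreTyped : Ctx → Tm → Tm → Prop
  | srt {Γ} (s : Srt) : PreTyped Γ (.srt s) (.srt .U)
  | var {Γ x A} : Has Γ x A → PreTyped Γ (.var x) A
  | pi0 {Γ A B s r} (t : Srt) :
      PreTyped Γ A (.srt s) → PreTyped (A :: Γ) B (.srt r) → PreTyped Γ (.pi0 t A B) (.srt t)
  | pi1 {Γ A B s r} (t : Srt) :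
      PreTyped Γ A (.srt s) → PreTyped (A :: Γ) B (.srt r) → PreTyped Γ (.pi1 t A B) (.srt t)
  | lam0 {Γ A B m s} (t : Srt) :
      PreTyped Γ A (.srt s) → PreTyped (A :: Γ) m B →
      PreTyped Γ (.lam0 t A m) (.pi0 t A B)
  | lam1 {Γ A B m s} (t : Srt) :
      PreTyped Γ A (.srt s) → PreTyped (A :: Γ) m B →
      PreTyped Γ (.lam1 t A m) (.pi1 t A B)
  | app0 {Γ m n A B t} :
      PreTyped Γ m (.pi0 t A B) → PreTyped Γ n A → PreTyped Γ (.app m n) (subst1 n B)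
  | app1 {Γ m n A B t} :
      PreTyped Γ m (.pi1 t A B) → PreTyped Γ n A → PreTyped Γ (.app m n) (subst1 n B)
  | conv {Γ m A B s} :
      PreTyped Γ m A → PreTyped Γ B (.srt s) → Conv A B → PreTyped Γ m B

/-- Well-formed contexts with respect to `PreTyped`. -/
inductive PreWf : Ctx → Prop
  | nil : PreWf []
  | cons {Γ A s} : PreWf Γ → PreTyped Γ A (.srt s) → PreWf (A :: Γ)

theorem PreWf.tail {Γ : Ctx} {A : Tm} (h : PreWf (A :: Γ)) : PreWf Γ := by
  cases h
  assumption

theorem LTyped.preTyped_and_preWf {Γ : Ctx} {m A : Tm} (h : LTyped Γ m A) :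
    PreTyped Γ m A ∧ PreWf Γ := by
  refine LTyped.rec (motive_1 := fun Γ _ => PreWf Γ)
    (motive_2 := fun Γ m A _ => PreTyped Γ m A ∧ PreWf Γ)
    .nil (fun _ _ hΓ hA => .cons hΓ hA.1) (fun s _ hΓ => ⟨.srt s, hΓ⟩)
    (fun _ hx hΓ => ⟨.var hx, hΓ⟩)
    (fun t _ _ hA hB => ⟨.pi0 t hA.1 hB.1, hA.2⟩)
    (fun t _ _ hA hB => ⟨.pi1 t hA.1 hB.1, hA.2⟩)
    (fun t _ hm => ?_) (fun t _ hm => ?_)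
    (fun _ _ hm hn => ⟨.app0 hm.1 hn.1, hm.2⟩)
    (fun _ _ hm hn => ⟨.app1 hm.1 hn.1, hm.2⟩)
    (fun _ _ hc hm hB => ⟨.conv hm.1 hB.1 hc, hm.2⟩) h
  · obtain ⟨hm, _ | ⟨hΓ, hA⟩⟩ := hm
    exact ⟨.lam0 t hA hm, hΓ⟩
  · obtain ⟨hm, _ | ⟨hΓ, hA⟩⟩ := hm
    exact ⟨.lam1 t hA hm, hΓ⟩

theorem Has.upr {Γ Γ' : Ctx} {ξ : Nat → Nat}
    (hξ : ∀ x A, Has Γ x A → Has Γ' (ξ x) (rename ξ A)) (A : Tm) (x : Nat) (B : Tm)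
    (h : Has (A :: Γ) x B) :
    Has (rename ξ A :: Γ') (TLL.upr ξ x) (rename (TLL.upr ξ) B) := by
  have comm (C : Tm) : rename (TLL.upr ξ) (rename Nat.succ C) =
      rename Nat.succ (rename ξ C) := by
    rw [rename_rename, rename_rename]
    rfl
  cases h with
  | zero => rw [comm]; exact .zero
  | succ h => rw [comm]; exact .succ (hξ _ _ h)

theorem PreTyped.rename {Γ : Ctx} {m A : Tm} (h : PreTyped Γ m A) {Γ' : Ctx} {ξ : Nat → Nat}
    (hξ : ∀ x A, Has Γ x A → Has Γ' (ξ x) (TLL.rename ξ A)) :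
    PreTyped Γ' (TLL.rename ξ m) (TLL.rename ξ A) := by
  induction h generalizing Γ' ξ with
  | srt s => exact .srt s
  | var hx => exact .var (hξ _ _ hx)
  | pi0 t _ _ ihA ihB => exact .pi0 t (ihA hξ) (ihB (Has.upr hξ _))
  | pi1 t _ _ ihA ihB => exact .pi1 t (ihA hξ) (ihB (Has.upr hξ _))
  | lam0 t _ _ ihA ihm => exact .lam0 t (ihA hξ) (ihm (Has.upr hξ _))
  | lam1 t _ _ ihA ihm => exact .lam1 t (ihA hξ) (ihm (Has.upr hξ _))
  | app0 _ _ ihm ihn => rw [rename_subst1]; exact .app0 (ihm hξ) (ihn hξ)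
  | app1 _ _ ihm ihn => rw [rename_subst1]; exact .app1 (ihm hξ) (ihn hξ)
  | conv _ _ hc ihm ihB => exact .conv (ihm hξ) (ihB hξ) (hc.rename ξ)

theorem PreTyped.weaken {Γ : Ctx} {m A : Tm} (h : PreTyped Γ m A) (B : Tm) :
    PreTyped (B :: Γ) (TLL.rename Nat.succ m) (TLL.rename Nat.succ A) :=
  h.rename fun _ _ => .succ

theorem PreTyped.up {Γ Γ' : Ctx} {σ : Nat → Tm}
    (hσ : ∀ x A, Has Γ x A → PreTyped Γ' (σ x) (subst σ A)) (A : Tm) (x : Nat) (B : Tm)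
    (h : Has (A :: Γ) x B) :
    PreTyped (subst σ A :: Γ') (TLL.up σ x) (subst (TLL.up σ) B) := by
  cases h with
  | zero => rw [subst_up_rename_succ]; exact .var .zero
  | succ h => rw [subst_up_rename_succ]; exact (hσ _ _ h).weaken _

theorem PreTyped.subst {Γ : Ctx} {m A : Tm} (h : PreTyped Γ m A) {Γ' : Ctx} {σ : Nat → Tm}
    (hσ : ∀ x A, Has Γ x A → PreTyped Γ' (σ x) (TLL.subst σ A)) :
    PreTyped Γ' (TLL.subst σ m) (TLL.subst σ A) := by
  induction h generalizing Γ' σ with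
  | srt s => exact .srt s
  | var hx => exact hσ _ _ hx
  | pi0 t _ _ ihA ihB => exact .pi0 t (ihA hσ) (ihB (PreTyped.up hσ _))
  | pi1 t _ _ ihA ihB => exact .pi1 t (ihA hσ) (ihB (PreTyped.up hσ _))
  | lam0 t _ _ ihA ihm => exact .lam0 t (ihA hσ) (ihm (PreTyped.up hσ _))
  | lam1 t _ _ ihA ihm => exact .lam1 t (ihA hσ) (ihm (PreTyped.up hσ _))
  | app0 _ _ ihm ihn => rw [subst_subst1]; exact .app0 (ihm hσ) (ihn hσ)
  | app1 _ _ ihm ihn => rw [subst_subst1]; exact .app1 (ihm hσ) (ihn hσ)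
  | conv _ _ hc ihm ihB => exact .conv (ihm hσ) (ihB hσ) (hc.subst σ)

theorem PreTyped.subst1 {Γ : Ctx} {m n A B : Tm} (hm : PreTyped (A :: Γ) m B)
    (hn : PreTyped Γ n A) : PreTyped Γ (TLL.subst1 n m) (TLL.subst1 n B) := by
  rw [subst1_eq, subst1_eq]
  refine hm.subst fun x C hx => ?_
  cases hx with
  | zero => rwa [subst_scons_rename_succ, subst_var]
  | succ hx => rw [subst_scons_rename_succ, subst_var]; exact .var hx

theorem PreTyped.conv_ctx {Γ : Ctx} {A A' m B : Tm} {s : Srt} (hm : PreTyped (A :: Γ) m B)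
    (hA : PreTyped Γ A (.srt s)) (hc : Conv A' A) : PreTyped (A' :: Γ) m B := by
  rw [← subst_var m, ← subst_var B]
  refine hm.subst fun x C hx => ?_
  rw [subst_var]
  cases hx with
  | zero => exact .conv (.var .zero) (hA.weaken A') (hc.rename _)
  | succ hx => exact .var (.succ hx)

theorem PreTyped.pi0_inv {Γ : Ctx} {t : Srt} {A B C : Tm} (h : PreTyped Γ (.pi0 t A B) C) :
    ∃ r, PreTyped (A :: Γ) B (.srt r) ∧ Conv (.srt t) C := by
  generalize hm : Tm.pi0 t A B = m at h
  induction h with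
  | pi0 _ _ hB => cases hm; exact ⟨_, hB, .refl _⟩
  | conv _ _ hc ih => obtain ⟨r, hB, h⟩ := ih hm; exact ⟨r, hB, h.trans hc⟩
  | _ => cases hm

theorem PreTyped.pi1_inv {Γ : Ctx} {t : Srt} {A B C : Tm} (h : PreTyped Γ (.pi1 t A B) C) :
    ∃ r, PreTyped (A :: Γ) B (.srt r) ∧ Conv (.srt t) C := by
  generalize hm : Tm.pi1 t A B = m at h
  induction h with
  | pi1 _ _ hB => cases hm; exact ⟨_, hB, .refl _⟩
  | conv _ _ hc ih => obtain ⟨r, hB, h⟩ := ih hm; exact ⟨r, hB, h.trans hc⟩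
  | _ => cases hm

theorem PreTyped.lam0_inv {Γ : Ctx} {t : Srt} {A m C : Tm} (h : PreTyped Γ (.lam0 t A m) C) :
    ∃ s B, PreTyped Γ A (.srt s) ∧ PreTyped (A :: Γ) m B ∧ Conv (.pi0 t A B) C := by
  generalize hm : Tm.lam0 t A m = n at h
  induction h with
  | lam0 _ hA hB => cases hm; exact ⟨_, _, hA, hB, .refl _⟩
  | conv _ _ hc ih => obtain ⟨s, B, hA, hB, h⟩ := ih hm; exact ⟨s, B, hA, hB, h.trans hc⟩
  | _ => cases hm

theorem PreTyped.lam1_inv {Γ : Ctx} {t : Srt} {A m C : Tm} (h : PreTyped Γ (.lam1 t A m) C) :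
    ∃ s B, PreTyped Γ A (.srt s) ∧ PreTyped (A :: Γ) m B ∧ Conv (.pi1 t A B) C := by
  generalize hm : Tm.lam1 t A m = n at h
  induction h with
  | lam1 _ hA hB => cases hm; exact ⟨_, _, hA, hB, .refl _⟩
  | conv _ _ hc ih => obtain ⟨s, B, hA, hB, h⟩ := ih hm; exact ⟨s, B, hA, hB, h.trans hc⟩
  | _ => cases hm

theorem PreWf.has {Γ : Ctx} (hΓ : PreWf Γ) {x : Nat} {A : Tm} (h : Has Γ x A) :
    ∃ s, PreTyped Γ A (.srt s) := by
  induction h with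
  | zero => cases hΓ with | cons _ hA => exact ⟨_, hA.weaken _⟩
  | succ _ ih => obtain ⟨s, hs⟩ := ih hΓ.tail; exact ⟨s, hs.weaken _⟩

theorem PreTyped.validity {Γ : Ctx} {m A : Tm} (h : PreTyped Γ m A) (hΓ : PreWf Γ) :
    ∃ s, PreTyped Γ A (.srt s) := by
  induction h with
  | srt | pi0 | pi1 => exact ⟨_, .srt _⟩
  | var hx => exact hΓ.has hx
  | lam0 t hA _ _ ih => obtain ⟨_, hB⟩ := ih (.cons hΓ hA); exact ⟨t, .pi0 t hA hB⟩
  | lam1 t hA _ _ ih => obtain ⟨_, hB⟩ := ih (.cons hΓ hA); exact ⟨t, .pi1 t hA hB⟩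
  | app0 _ hn ih _ =>
    obtain ⟨_, hP⟩ := ih hΓ
    obtain ⟨r, hB, -⟩ := hP.pi0_inv
    exact ⟨r, hB.subst1 hn⟩
  | app1 _ hn ih _ =>
    obtain ⟨_, hP⟩ := ih hΓ
    obtain ⟨r, hB, -⟩ := hP.pi1_inv
    exact ⟨r, hB.subst1 hn⟩
  | conv _ hB => exact ⟨_, hB⟩

theorem PreTyped.lStep {Γ : Ctx} {m A : Tm} (h : PreTyped Γ m A) (hΓ : PreWf Γ) {n : Tm}
    (hs : LStep m n) : PreTyped Γ n A := by
  induction h generalizing n with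
  | srt | var => cases hs
  | pi0 t hA hB ihA ihB =>
    cases hs with
    | pi0A h => exact .pi0 t (ihA hΓ h) (hB.conv_ctx hA h.toConv.symm)
    | pi0B h => exact .pi0 t hA (ihB (.cons hΓ hA) h)
  | pi1 t hA hB ihA ihB =>
    cases hs with
    | pi1A h => exact .pi1 t (ihA hΓ h) (hB.conv_ctx hA h.toConv.symm)
    | pi1B h => exact .pi1 t hA (ihB (.cons hΓ hA) h)
  | lam0 t hA hm ihA ihm =>
    cases hs with
    | lam0A h =>
      obtain ⟨_, hP⟩ := (PreTyped.lam0 t hA hm).validity hΓ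
      exact .conv (.lam0 t (ihA hΓ h) (hm.conv_ctx hA h.toConv.symm)) hP
        (LStep.pi0A h).toConv.symm
    | lam0M h => exact .lam0 t hA (ihm (.cons hΓ hA) h)
  | lam1 t hA hm ihA ihm =>
    cases hs with
    | lam1A h =>
      obtain ⟨_, hP⟩ := (PreTyped.lam1 t hA hm).validity hΓ
      exact .conv (.lam1 t (ihA hΓ h) (hm.conv_ctx hA h.toConv.symm)) hP
        (LStep.pi1A h).toConv.symm
    | lam1M h => exact .lam1 t hA (ihm (.cons hΓ hA) h)
  | app0 hm hn ihm ihn =>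
    obtain ⟨_, hT⟩ := (PreTyped.app0 hm hn).validity hΓ
    cases hs with
    | appL h => exact .app0 (ihm hΓ h) hn
    | appR h => exact .conv (.app0 hm (ihn hΓ h)) hT (h.conv_subst1 _).symm
    | beta0 =>
      obtain ⟨_, _, hA, hb, hc⟩ := hm.lam0_inv
      exact .conv (hb.subst1 (.conv hn hA hc.pi0_inj.1.symm)) hT (hc.pi0_inj.2.subst1 _)
    | beta1 =>
      obtain ⟨_, _, -, -, hc⟩ := hm.lam1_inv
      exact (not_conv_pi0_pi1 hc.symm).elim
  | app1 hm hn ihm ihn =>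
    obtain ⟨_, hT⟩ := (PreTyped.app1 hm hn).validity hΓ
    cases hs with
    | appL h => exact .app1 (ihm hΓ h) hn
    | appR h => exact .conv (.app1 hm (ihn hΓ h)) hT (h.conv_subst1 _).symm
    | beta0 =>
      obtain ⟨_, _, -, -, hc⟩ := hm.lam0_inv
      exact (not_conv_pi0_pi1 hc).elim
    | beta1 =>
      obtain ⟨_, _, hA, hb, hc⟩ := hm.lam1_inv
      exact .conv (hb.subst1 (.conv hn hA hc.pi1_inj.1.symm)) hT (hc.pi1_inj.2.subst1 _)
  | conv _ hB hc ihm _ => exact .conv (ihm hΓ hs) hB hc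

theorem PreTyped.lRed {Γ : Ctx} {m n A : Tm} (h : PreTyped Γ m A) (hΓ : PreWf Γ)
    (hs : LRed m n) : PreTyped Γ n A := by
  induction hs with
  | refl => exact h
  | tail _ hs ih => exact ih.lStep hΓ hs

theorem LTyped.srt_eq_of_conv_pi0 {Γ : Ctx} {A A₀ B₀ : Tm} {s t : Srt}
    (h : LTyped Γ A (.srt s)) (hc : Conv (.pi0 t A₀ B₀) A) : t = s := by
  obtain ⟨hA, hΓ⟩ := h.preTyped_and_preWf
  obtain ⟨C, h₁, h₂⟩ := hc.join
  obtain ⟨_, _, rfl, -, -⟩ := h₁.pi0_inv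
  obtain ⟨_, -, hs⟩ := (hA.lRed hΓ h₂).pi0_inv
  exact hs.srt_inj

theorem LTyped.srt_eq_of_conv_pi1 {Γ : Ctx} {A A₀ B₀ : Tm} {s t : Srt}
    (h : LTyped Γ A (.srt s)) (hc : Conv (.pi1 t A₀ B₀) A) : t = s := by
  obtain ⟨hA, hΓ⟩ := h.preTyped_and_preWf
  obtain ⟨C, h₁, h₂⟩ := hc.join
  obtain ⟨_, _, rfl, -, -⟩ := h₁.pi1_inv
  obtain ⟨_, -, hs⟩ := (hA.lRed hΓ h₂).pi1_inv
  exact hs.srt_inj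

/-! ### Erasure inversion -/

theorem Erase.not_var_of_nil {Γ : Ctx} {a A : Tm} {x : Nat} :
    ¬ Erase Γ [] a (.var x) A := by
  intro h
  generalize hb : Tm.var x = b at h
  generalize hΔ : ([] : PCtx) = Δ at h
  induction h with
  | var _ hx => subst hΔ; cases hx
  | conv _ _ _ ih => exact ih hb hΔ
  | _ => cases hb

theorem Erase.lam0_inv {Γ : Ctx} {Δ : PCtx} {a X m A : Tm} {t : Srt}
    (h : Erase Γ Δ a (.lam0 t X m) A) : ∃ A₀ B₀, Conv (.pi0 t A₀ B₀) A := by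
  generalize hb : Tm.lam0 t X m = b at h
  induction h with
  | lam0 => cases hb; exact ⟨_, _, .refl _⟩
  | conv _ _ hc ih => obtain ⟨A₀, B₀, h⟩ := ih hb; exact ⟨A₀, B₀, h.trans hc⟩
  | _ => cases hb

theorem Erase.lam1_inv {Γ : Ctx} {Δ : PCtx} {a X m A : Tm} {t : Srt}
    (h : Erase Γ Δ a (.lam1 t X m) A) : ∃ A₀ B₀, Conv (.pi1 t A₀ B₀) A := by
  generalize hb : Tm.lam1 t X m = b at h
  induction h with
  | lam1 => cases hb; exact ⟨_, _, .refl _⟩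
  | conv _ _ hc ih => obtain ⟨A₀, B₀, h⟩ := ih hb; exact ⟨A₀, B₀, h.trans hc⟩
  | _ => cases hb

/-! ### Heaps -/

theorem WrHeap.lookup {H : Heap} (hH : WrHeap H) {l : Nat} {t : Srt} {v : Tm}
    (h : H l = some (t, v)) : ∃ m, v = .lam0 t .box m ∨ v = .lam1 t .box m := by
  induction hH with
  | nil => cases h
  | lam0 _ _ _ ih =>
    rw [Function.update_apply] at h
    split at h
    · cases h; exact ⟨_, .inl rfl⟩
    · exact ih h
  | lam1 _ _ _ ih =>
    rw [Function.update_apply] at h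
    split at h
    · cases h; exact ⟨_, .inr rfl⟩
    · exact ih h

theorem Resolve.hRestr_of_lam0 {H : Heap} (hH : WrHeap H) {c X m : Tm} {t : Srt}
    (h : Resolve H c (.lam0 t X m)) : HRestr H t := by
  cases h with
  | lam0 ht => exact ht
  | ptr hl hr =>
    cases hl with
    | u hl =>
      obtain ⟨_, rfl | rfl⟩ := hH.lookup hl <;> cases hr
      assumption
    | l hl =>
      obtain ⟨_, rfl | rfl⟩ := hH.lookup hl <;> cases hr
      trivial

theorem Resolve.hRestr_of_lam1 {H : Heap} (hH : WrHeap H) {c X m : Tm} {t : Srt}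
    (h : Resolve H c (.lam1 t X m)) : HRestr H t := by
  cases h with
  | lam1 ht => exact ht
  | ptr hl hr =>
    cases hl with
    | u hl =>
      obtain ⟨_, rfl | rfl⟩ := hH.lookup hl <;> cases hr
      assumption
    | l hl =>
      obtain ⟨_, rfl | rfl⟩ := hH.lookup hl <;> cases hr
      trivial

/-- Resolution stability. -/
theorem resolution_stability {H : Heap} {a b c A : Tm} {s : Srt}
    (hwr : WellResolved H a b c A) (hA : LTyped [] A (.srt s))
    (hH : WrHeap H) (hv : Value b) :
    HRestr H s := by
  obtain ⟨he, hr⟩ := hwr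
  cases hv with
  | var => exact (he.not_var_of_nil).elim
  | lam0 =>
    obtain ⟨_, _, hc⟩ := he.lam0_inv
    exact hA.srt_eq_of_conv_pi0 hc ▸ hr.hRestr_of_lam0 hH
  | lam1 =>
    obtain ⟨_, _, hc⟩ := he.lam1_inv
    exact hA.srt_eq_of_conv_pi1 hc ▸ hr.hRestr_of_lam1 hH
end TLL
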